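/- arXiv:1502.01074 — 6 statements merged into one kernel-verified Lean document; each statement's English description precedes it below -/
import Mathlib

section
/- Let G be a strongly connected simple directed graph on n > 1 vertices and let w ∈ Sp(V). If 𝒢_i and 𝒢_j are principal subsets of the set of cycles of G with 𝒢_i ≻ 𝒢_j (i.e. Co(𝒢_i) ⊋ Co(𝒢_j)), then 𝒢_i ⊋ 𝒢_j as sets of cycles. -/
open Matrix Finset
open scoped Classical

noncomputable section

/-- `A` is an infinitesimal stochastic matrix (ISM): all off-diagonal entries are
nonnegative and every row sums to zero. -/
def IsISM {n : ℕ} (A : Matrix (Fin n) (Fin n) ℝ) : Prop :=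
  (∀ i j, i ≠ j → 0 ≤ A i j) ∧ ∀ i, ∑ j, A i j = 0

/-- `A` has the zero pattern prescribed by the digraph with edge relation `E`:
`A i j = 0` whenever `i ≠ j` and `i → j` is not an edge. -/
def InPattern {n : ℕ} (E : Fin n → Fin n → Prop) (A : Matrix (Fin n) (Fin n) ℝ) : Prop :=
  ∀ i j, i ≠ j → ¬ E i j → A i j = 0

/-- `r` is a root of the digraph `E`: every vertex has a directed path to `r`. -/
def IsRootOf {n : ℕ} (E : Fin n → Fin n → Prop) (r : Fin n) : Prop :=
  ∀ i, Relation.ReflTransGen E i r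

/-- The digraph `E` is rooted. -/
def Rooted {n : ℕ} (E : Fin n → Fin n → Prop) : Prop :=
  ∃ r, IsRootOf E r

/-- `w` lies in the standard simplex `Sp[V]`. -/
def MemSimplex {n : ℕ} (w : Fin n → ℝ) : Prop :=
  (∀ i, 0 ≤ w i) ∧ ∑ i, w i = 1

/-- `0` is a simple eigenvalue of `A`: it is a root of multiplicity exactly one of
the characteristic polynomial of `A`. -/
def SimpleZeroEig {n : ℕ} (A : Matrix (Fin n) (Fin n) ℝ) : Prop :=
  Polynomial.rootMultiplicity 0 (Matrix.charpoly A) = 1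

/-- `A ∈ 𝔸_G(w)`: the set of `w`-feasible dynamics. -/
def Feasible {n : ℕ} (E : Fin n → Fin n → Prop) (w : Fin n → ℝ)
    (A : Matrix (Fin n) (Fin n) ℝ) : Prop :=
  IsISM A ∧ InPattern E A ∧ SimpleZeroEig A ∧ Aᵀ *ᵥ w = 0

/-- `S` is a relevant subset of the digraph `E`: it consists of roots and the induced
subgraph on `S` is strongly connected (paths staying inside `S`). -/
def RelevantSubset {n : ℕ} (E : Fin n → Fin n → Prop) (S : Set (Fin n)) : Prop :=
  (∀ i ∈ S, IsRootOf E i) ∧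
    ∀ i ∈ S, ∀ j ∈ S, Relation.ReflTransGen (fun a b => E a b ∧ a ∈ S ∧ b ∈ S) i j

/-- `c` is (the edge relation of) a cycle of the digraph `E`: there are distinct
vertices `v 0, …, v (m+1)` (hence at least two of them), each edge `v t → v (t+1)`
(indices cyclic) is an edge of `E`, and the edges of `c` are exactly these edges. -/
def IsCycleOf {n : ℕ} (E : Fin n → Fin n → Prop) (c : Fin n → Fin n → Prop) : Prop :=
  ∃ (m : ℕ) (v : Fin (m + 2) → Fin n), Function.Injective v ∧
    (∀ t, E (v t) (v (t + 1))) ∧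
    ∀ i j, c i j ↔ ∃ t, v t = i ∧ v (t + 1) = j

/-- The ISM associated with a cycle `c` and the weight vector `w`: off-diagonal
entries are `1 / w j` on the edges of the cycle and `0` otherwise, and the diagonal
entries are chosen so that every row sums to zero. -/
noncomputable def cycleISM {n : ℕ} (w : Fin n → ℝ) (c : Fin n → Fin n → Prop) :
    Matrix (Fin n) (Fin n) ℝ :=
  Matrix.of fun i j =>
    if i = j then -(∑ l ∈ Finset.univ.erase i, if c i l then (w i)⁻¹ else 0)
    else if c i j then (w i)⁻¹ else 0

/-- Given an enumeration `Gc` of the cycles of a digraph on `Fin n`, a set `S` of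
indices of cycles is principal if the digraph whose edge set is the union of the
edge sets of the chosen cycles is strongly connected. -/
def PrincipalSubset {n k : ℕ} (Gc : Fin k → Fin n → Fin n → Prop) (S : Finset (Fin k)) : Prop :=
  ∀ i j : Fin n, Relation.ReflTransGen (fun a b => ∃ s ∈ S, Gc s a b) i j

/-- `Co(𝒢')`: the set of strictly positive linear combinations of the matrices
`C s`, `s ∈ S`. -/
def coOpen {n k : ℕ} (C : Fin k → Matrix (Fin n) (Fin n) ℝ) (S : Finset (Fin k)) :
    Set (Matrix (Fin n) (Fin n) ℝ) :=
  {A | ∃ α : Fin k → ℝ, (∀ s ∈ S, 0 < α s) ∧ A = ∑ s ∈ S, α s • C s}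

namespace IsCycleOf

variable {n : ℕ} {E c d : Fin n → Fin n → Prop}

theorem le (hc : IsCycleOf E c) {i j : Fin n} (h : c i j) : E i j := by
  obtain ⟨m, v, -, hE, hv⟩ := hc
  obtain ⟨t, rfl, rfl⟩ := (hv i j).1 h
  exact hE t

theorem exists_edge (hc : IsCycleOf E c) : ∃ i j, c i j := by
  obtain ⟨m, v, -, -, hv⟩ := hc
  exact ⟨v 0, v (0 + 1), (hv _ _).2 ⟨0, rfl, rfl⟩⟩

theorem right_unique (hc : IsCycleOf E c) {i j j' : Fin n} (h : c i j) (h' : c i j') :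
    j = j' := by
  obtain ⟨m, v, hinj, -, hv⟩ := hc
  obtain ⟨t, rfl, rfl⟩ := (hv i j).1 h
  obtain ⟨t', ht', rfl⟩ := (hv _ j').1 h'
  rw [hinj ht']

theorem exists_next (hc : IsCycleOf E c) {i j : Fin n} (h : c i j) : ∃ k, c j k := by
  obtain ⟨m, v, -, -, hv⟩ := hc
  obtain ⟨t, rfl, rfl⟩ := (hv i j).1 h
  exact ⟨_, (hv _ _).2 ⟨t + 1, rfl, rfl⟩⟩

open Fin.CommRing in
theorem reflTransGen (hc : IsCycleOf E c) {i j i' j' : Fin n} (h : c i j) (h' : c i' j') :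
    Relation.ReflTransGen c i i' := by
  obtain ⟨m, v, -, -, hv⟩ := hc
  obtain ⟨a, rfl, rfl⟩ := (hv i j).1 h
  obtain ⟨b, rfl, rfl⟩ := (hv i' j').1 h'
  have key (r : ℕ) : Relation.ReflTransGen c (v a) (v (a + (r : Fin (m + 2)))) := by
    induction r with
    | zero => simpa using Relation.ReflTransGen.refl
    | succ r ih => exact ih.tail ((hv _ _).2 ⟨_, rfl, by push_cast; rw [add_assoc]⟩)
  simpa using key (b - a).val

/-- A cycle contained in another cycle is equal to it. -/
theorem eq_of_le (hc : IsCycleOf E c) (hd : IsCycleOf E d) (hle : ∀ i j, d i j → c i j) :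
    d = c := by
  obtain ⟨i₀, j₀, h₀⟩ := hd.exists_edge
  have reach {x : Fin n} (hx : Relation.ReflTransGen c i₀ x) : ∃ y, d x y := by
    induction hx with
    | refl => exact ⟨j₀, h₀⟩
    | tail _ hyz ih =>
      obtain ⟨y', hy'⟩ := ih
      obtain rfl := hc.right_unique hyz (hle _ _ hy')
      exact hd.exists_next hy'
  ext i j
  refine ⟨hle i j, fun hij => ?_⟩
  obtain ⟨j', hj'⟩ := reach (hc.reflTransGen (hle _ _ h₀) hij)
  rwa [hc.right_unique hij (hle _ _ hj')]

end IsCycleOf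

/-- The functional `A ↦ ∑ i ≠ j, w i * A i j * g i j`, with `g = 1` on the edges of `c` and
`g = -n ^ 2` elsewhere; it is positive on the ISM of the cycle `c` and negative on the ISM of
every other cycle. -/
def separatingFunctional {n : ℕ} (w : Fin n → ℝ) (c : Fin n → Fin n → Prop) :
    Matrix (Fin n) (Fin n) ℝ →ₗ[ℝ] ℝ where
  toFun A := ∑ p : Fin n × Fin n,
    if p.1 = p.2 then 0 else w p.1 * A p.1 p.2 * if c p.1 p.2 then 1 else -(n : ℝ) ^ 2
  map_add' A B := by
    rw [← Finset.sum_add_distrib]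
    refine Finset.sum_congr rfl fun p _ => ?_
    rw [Matrix.add_apply]
    split_ifs <;> ring
  map_smul' r A := by
    rw [RingHom.id_apply, smul_eq_mul, Finset.mul_sum]
    refine Finset.sum_congr rfl fun p _ => ?_
    rw [Matrix.smul_apply, smul_eq_mul]
    split_ifs <;> ring

section Separation

variable {n : ℕ} {E c d : Fin n → Fin n → Prop} {w : Fin n → ℝ}

theorem separatingFunctional_cycleISM (hw : ∀ i, 0 < w i) (hd : ∀ i, ¬ d i i) :
    separatingFunctional w c (cycleISM w d) =
      ∑ p : Fin n × Fin n,
        if d p.1 p.2 then (if c p.1 p.2 then 1 else -(n : ℝ) ^ 2) else 0 := by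
  change ∑ p : Fin n × Fin n, _ = _
  refine Finset.sum_congr rfl fun p _ => ?_
  have hp := (hw p.1).ne'
  by_cases h : p.1 = p.2
  · have := hd p.2
    simp [h, this]
  · by_cases h' : d p.1 p.2 <;> simp [cycleISM, h, h', hp]

theorem separatingFunctional_self_pos (hE : ∀ i, ¬ E i i) (hw : ∀ i, 0 < w i)
    (hc : IsCycleOf E c) : 0 < separatingFunctional w c (cycleISM w c) := by
  rw [separatingFunctional_cycleISM hw fun i h => hE i (hc.le h)]
  obtain ⟨i, j, hij⟩ := hc.exists_edge
  refine Finset.sum_pos' (fun p _ => ?_) ⟨(i, j), Finset.mem_univ _, by simp [hij]⟩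
  split_ifs <;> norm_num

theorem separatingFunctional_neg (hE : ∀ i, ¬ E i i) (hw : ∀ i, 0 < w i)
    (hc : IsCycleOf E c) (hd : IsCycleOf E d) (hne : d ≠ c) :
    separatingFunctional w c (cycleISM w d) < 0 := by
  rw [separatingFunctional_cycleISM hw fun i h => hE i (hd.le h)]
  obtain ⟨i, j, hdij, hcij⟩ : ∃ i j, d i j ∧ ¬ c i j := by
    by_contra! h
    exact hne (hc.eq_of_le hd h)
  rw [← Finset.add_sum_erase _ _ (Finset.mem_univ (i, j))]
  have hrest : ∑ p ∈ Finset.univ.erase (i, j),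
      (if d p.1 p.2 then (if c p.1 p.2 then 1 else -(n : ℝ) ^ 2) else 0) ≤
        ((Finset.univ.erase (i, j)).card : ℝ) := by
    rw [← nsmul_one (Finset.card _)]
    refine Finset.sum_le_card_nsmul _ _ _ fun p _ => ?_
    split_ifs <;> nlinarith [sq_nonneg (n : ℝ)]
  have hcard : ((Finset.univ.erase (i, j)).card : ℝ) + 1 = (n : ℝ) ^ 2 := by
    have := Finset.card_erase_add_one (Finset.mem_univ (i, j))
    rw [Finset.card_univ, Fintype.card_prod, Fintype.card_fin] at this
    rw [sq]
    exact_mod_cast this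
  simp only [hdij, hcij, if_true, if_false]
  linarith

end Separation

/-- Lemma 4: if `𝒢_i ≻ 𝒢_j`, i.e. `Co(𝒢_i) ⊋ Co(𝒢_j)`, for principal subsets, then
`𝒢_i ⊋ 𝒢_j` as sets of cycles. -/
theorem principal_ssubset_of_coOpen_ssubset
    (n k : ℕ) (hn : 1 < n)
    (E : Fin n → Fin n → Prop) (hsimple : ∀ i, ¬ E i i)
    (hsc : ∀ i j : Fin n, Relation.ReflTransGen E i j)
    (w : Fin n → ℝ) (hw : ∀ i, 0 < w i) (hw1 : ∑ i, w i = 1)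
    (Gc : Fin k → Fin n → Fin n → Prop)
    (hcyc : ∀ t, IsCycleOf E (Gc t)) (hinj : Function.Injective Gc)
    (hall : ∀ c, IsCycleOf E c → ∃ t, Gc t = c)
    (S₁ S₂ : Finset (Fin k))
    (hS₁ : PrincipalSubset Gc S₁) (hS₂ : PrincipalSubset Gc S₂)
    (hsucc : coOpen (fun t => cycleISM w (Gc t)) S₂ ⊂ coOpen (fun t => cycleISM w (Gc t)) S₁) :
    S₂ ⊂ S₁ := by
  have hsub : S₂ ⊆ S₁ := by
    intro t ht
    by_contra ht₁
    obtain ⟨f, hpos, hneg⟩ : ∃ f : Matrix (Fin n) (Fin n) ℝ →ₗ[ℝ] ℝ,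
        0 < f (cycleISM w (Gc t)) ∧ ∀ s ≠ t, f (cycleISM w (Gc s)) < 0 :=
      ⟨separatingFunctional w (Gc t), separatingFunctional_self_pos hsimple hw (hcyc t),
        fun s hs => separatingFunctional_neg hsimple hw (hcyc t) (hcyc s) (hinj.ne hs)⟩
    generalize hC : (fun s => cycleISM w (Gc s)) = C at hsucc
    simp only [funext_iff] at hC
    simp only [hC] at hpos hneg
    obtain ⟨R, hR⟩ : ∃ R : ℝ, R = ∑ s ∈ S₂.erase t, f (C s) := ⟨_, rfl⟩
    obtain ⟨M, hM, hMR⟩ : ∃ M : ℝ, 0 < M ∧ 0 < M * f (C t) + R := by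
      refine ⟨(|R| + 1) / f (C t), by positivity, ?_⟩
      rw [div_mul_cancel₀ _ hpos.ne']
      linarith [neg_abs_le R]
    let α : Fin k → ℝ := fun s => if s = t then M else 1
    have hA : ∑ s ∈ S₂, α s • C s ∈ coOpen C S₂ :=
      ⟨α, fun s _ => by simp only [α]; split_ifs <;> linarith, rfl⟩
    obtain ⟨β, hβ, hAβ⟩ := hsucc.subset hA
    have hfA : f (∑ s ∈ S₂, α s • C s) = M * f (C t) + R := by
      rw [← Finset.add_sum_erase _ _ ht, map_add, map_smul, map_sum, hR]
      congr 1
      · simp [α]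
      · refine Finset.sum_congr rfl fun s hs => ?_
        simp [α, Finset.ne_of_mem_erase hs]
    have hfB : f (∑ s ∈ S₁, β s • C s) ≤ 0 := by
      rw [map_sum]
      refine Finset.sum_nonpos fun s hs => ?_
      rw [map_smul, smul_eq_mul]
      exact (mul_neg_of_pos_of_neg (hβ s hs) (hneg s (ne_of_mem_of_not_mem hs ht₁))).le
    rw [← hAβ, hfA] at hfB
    exact hMR.not_ge hfB
  refine hsub.ssubset_of_ne ?_
  rintro rfl
  exact hsucc.ne rfl
end
end

section
/- Let G be a strongly connected simple directed graph on n > 1 vertices, let w ∈ Sp(V), and let 𝒢_i ⊋ 𝒢_j be principal subsets of the set of cycles of G. If L(𝒢_i) = L(𝒢_j), then 𝒢_i ≻ 𝒢_j, i.e. Co(𝒢_i) ⊋ Co(𝒢_j). -/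
open Matrix Finset
open scoped Classical

noncomputable section

open Filter Topology in
/-- Enlarging the index set inside a fixed span enlarges the open cone. -/
theorem coOpen_subset_of_mem_span {n k : ℕ} (C : Fin k → Matrix (Fin n) (Fin n) ℝ)
    {S T : Finset (Fin k)} (hST : S ⊆ T)
    (hspan : ∀ t ∈ T, C t ∈ Submodule.span ℝ (C '' (↑S : Set (Fin k)))) :
    coOpen C S ⊆ coOpen C T := by
  rintro A ⟨α, hα, rfl⟩
  have hmem : ∑ t ∈ T \ S, C t ∈ Submodule.span ℝ (C '' (↑S : Set (Fin k))) :=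
    Submodule.sum_mem _ fun t ht => hspan t (Finset.mem_sdiff.1 ht).1
  obtain ⟨β, hβ⟩ := Submodule.mem_span_image_finset_iff_exists_fun' ℝ |>.1 hmem
  have hev : ∀ᶠ ε : ℝ in 𝓝[>] 0, ∀ s ∈ S, 0 < α s - ε * β s := by
    refine (eventually_all_finset S).2 fun s hs => ?_
    have hcont : Continuous fun ε : ℝ => α s - ε * β s := by fun_prop
    refine (hcont.continuousAt.eventually_const_lt ?_).filter_mono nhdsWithin_le_nhds
    simpa using hα s hs
  obtain ⟨ε, hε, hpos⟩ := (hev.and self_mem_nhdsWithin).exists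
  refine ⟨fun s => if s ∈ S then α s - ε * β s else ε, fun s _ => ?_, ?_⟩
  · dsimp only
    split_ifs with h
    exacts [hε s h, hpos]
  · rw [← Finset.sum_sdiff hST]
    have hout : ∑ s ∈ T \ S, (if s ∈ S then α s - ε * β s else ε) • C s
        = ε • ∑ s ∈ T \ S, C s := by
      rw [Finset.smul_sum]
      exact Finset.sum_congr rfl fun s hs => by rw [if_neg (Finset.mem_sdiff.1 hs).2]
    have hin : ∑ s ∈ S, (if s ∈ S then α s - ε * β s else ε) • C s
        = ∑ s ∈ S, (α s • C s - ε • β s • C s) :=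
      Finset.sum_congr rfl fun s hs => by rw [if_pos hs, sub_smul, mul_smul]
    rw [hout, hin, ← hβ, Finset.sum_sub_distrib, ← Finset.smul_sum, add_sub_cancel]

open Fin.NatCast Fin.CommRing in
/-- A cycle contained in another cycle is equal to it. -/
theorem IsCycleOf.eq_of_imp {n : ℕ} {E c d : Fin n → Fin n → Prop} (hc : IsCycleOf E c)
    (hd : IsCycleOf E d) (hcd : ∀ i j, c i j → d i j) : c = d := by
  obtain ⟨m, v, -, -, hcv⟩ := hc
  obtain ⟨p, u, hu, -, hdu⟩ := hd
  have hstart : ∃ t, c (u t) (u (t + 1)) := by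
    have h0 : c (v 0) (v (0 + 1)) := (hcv _ _).2 ⟨0, rfl, rfl⟩
    obtain ⟨t, h1, h2⟩ := (hdu _ _).1 (hcd _ _ h0)
    exact ⟨t, by rwa [h1, h2]⟩
  have hstep : ∀ r, c (u r) (u (r + 1)) → c (u (r + 1)) (u (r + 1 + 1)) := by
    intro r hr
    obtain ⟨s, -, hs⟩ := (hcv _ _).1 hr
    have hnext : c (v (s + 1)) (v (s + 1 + 1)) := (hcv _ _).2 ⟨s + 1, rfl, rfl⟩
    obtain ⟨q, h1, h2⟩ := (hdu _ _).1 (hcd _ _ hnext)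
    obtain rfl : q = r + 1 := hu (h1.trans hs)
    rwa [h1, h2]
  obtain ⟨t, ht⟩ := hstart
  have hiter : ∀ l : ℕ, c (u (t + (l : Fin (p + 2)))) (u (t + (l : Fin (p + 2)) + 1)) := by
    intro l
    induction l with
    | zero => simpa using ht
    | succ l ih => simpa [add_assoc] using hstep _ ih
  have hall : ∀ r, c (u r) (u (r + 1)) := fun r => by
    simpa using hiter (r - t).val
  funext i j
  refine propext ⟨hcd i j, fun h => ?_⟩
  obtain ⟨r, rfl, rfl⟩ := (hdu _ _).1 h
  exact hall r

/-- A cycle has at least one edge. -/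
theorem IsCycleOf.exists_edge_s13 {n : ℕ} {E c : Fin n → Fin n → Prop} (hc : IsCycleOf E c) :
    ∃ i j, c i j := by
  obtain ⟨m, v, -, -, hcv⟩ := hc
  exact ⟨v 0, v (0 + 1), (hcv _ _).2 ⟨0, rfl, rfl⟩⟩

/-- Every edge of a cycle is an edge of the ambient digraph. -/
theorem IsCycleOf.edge {n : ℕ} {E c : Fin n → Fin n → Prop} (hc : IsCycleOf E c) {i j : Fin n}
    (h : c i j) : E i j := by
  obtain ⟨m, v, -, hE, hcv⟩ := hc
  obtain ⟨t, rfl, rfl⟩ := (hcv _ _).1 h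
  exact hE t

theorem sum_smul_cycleISM_apply {n k : ℕ} (w : Fin n → ℝ) (Gc : Fin k → Fin n → Fin n → Prop)
    (S : Finset (Fin k)) (α : Fin k → ℝ) {i j : Fin n} (hij : i ≠ j) :
    (∑ s ∈ S, α s • cycleISM w (Gc s)) i j = (∑ s ∈ S, if Gc s i j then α s else 0) * (w i)⁻¹ := by
  rw [Matrix.sum_apply, Finset.sum_mul]
  refine Finset.sum_congr rfl fun s _ => ?_
  simp [cycleISM, hij]

/-- Lemma 5, case 1: for principal subsets with `𝒢_j ⊊ 𝒢_i`, if the spans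
`L(𝒢_i)` and `L(𝒢_j)` coincide, then `Co(𝒢_j) ⊊ Co(𝒢_i)`, i.e. `𝒢_i ≻ 𝒢_j`. -/
theorem coOpen_ssubset_of_span_eq
    (n k : ℕ) (hn : 1 < n)
    (E : Fin n → Fin n → Prop) (hsimple : ∀ i, ¬ E i i)
    (hsc : ∀ i j : Fin n, Relation.ReflTransGen E i j)
    (w : Fin n → ℝ) (hw : ∀ i, 0 < w i) (hw1 : ∑ i, w i = 1)
    (Gc : Fin k → Fin n → Fin n → Prop)
    (hcyc : ∀ t, IsCycleOf E (Gc t)) (hinj : Function.Injective Gc)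
    (hall : ∀ c, IsCycleOf E c → ∃ t, Gc t = c)
    (S₁ S₂ : Finset (Fin k))
    (hS₁ : PrincipalSubset Gc S₁) (hS₂ : PrincipalSubset Gc S₂)
    (hss : S₂ ⊂ S₁)
    (hspan : Submodule.span ℝ ((fun t => cycleISM w (Gc t)) '' (↑S₁ : Set (Fin k))) =
      Submodule.span ℝ ((fun t => cycleISM w (Gc t)) '' (↑S₂ : Set (Fin k)))) :
    coOpen (fun t => cycleISM w (Gc t)) S₂ ⊂ coOpen (fun t => cycleISM w (Gc t)) S₁ := by
  have hsub := coOpen_subset_of_mem_span (fun t => cycleISM w (Gc t)) hss.1 fun t ht =>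
    hspan ▸ Submodule.subset_span (Set.mem_image_of_mem _ ht)
  refine ⟨hsub, fun hsup => ?_⟩
  obtain ⟨t, ht₁, ht₂⟩ := Finset.exists_of_ssubset hss
  let α : Fin k → ℝ := fun s => if s = t then (k : ℝ) * k + 1 else 1
  have hα : ∀ s, 0 < α s := fun s => by
    dsimp only [α]
    split_ifs <;> positivity
  obtain ⟨γ, hγ, heq⟩ := hsup ⟨α, fun s _ => hα s, rfl⟩
  have hentry : ∀ i j, i ≠ j → (∑ s ∈ S₁, if Gc s i j then α s else 0)
      = ∑ s ∈ S₂, if Gc s i j then γ s else 0 := by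
    intro i j hij
    have h := congrFun (congrFun heq i) j
    dsimp only at h
    rw [sum_smul_cycleISM_apply w Gc S₁ α hij, sum_smul_cycleISM_apply w Gc S₂ γ hij] at h
    exact mul_right_cancel₀ (inv_ne_zero (hw i).ne') h
  have hne : ∀ s i j, Gc s i j → i ≠ j := fun s i j h hij =>
    hsimple i (by simpa [← hij] using (hcyc s).edge h)
  have hcard : ∀ S : Finset (Fin k), (#S : ℝ) ≤ k := fun S => by
    exact_mod_cast (Finset.card_le_univ S).trans_eq (Fintype.card_fin k)
  have hγle : ∀ s ∈ S₂, γ s ≤ k := by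
    intro s hs
    have hst : s ≠ t := fun h => ht₂ (h ▸ hs)
    obtain ⟨i, j, hsij, htij⟩ : ∃ i j, Gc s i j ∧ ¬ Gc t i j := by
      by_contra! h
      exact hst (hinj ((hcyc s).eq_of_imp (hcyc t) h))
    calc γ s = if Gc s i j then γ s else 0 := (if_pos hsij).symm
      _ ≤ ∑ r ∈ S₂, if Gc r i j then γ r else 0 :=
        Finset.single_le_sum (f := fun r => if Gc r i j then γ r else 0)
          (fun r hr => by split_ifs; exacts [(hγ r hr).le, le_rfl]) hs
      _ = ∑ r ∈ S₁, if Gc r i j then α r else 0 := (hentry i j (hne s i j hsij)).symm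
      _ ≤ ∑ r ∈ S₁, (1 : ℝ) := Finset.sum_le_sum fun r _ => by
        by_cases hrt : r = t
        · simp [hrt, htij]
        · simp only [α, if_neg hrt]
          split_ifs <;> norm_num
      _ ≤ k := by simpa using hcard S₁
  obtain ⟨i, j, htij⟩ := (hcyc t).exists_edge_s13
  have hlt : (k : ℝ) * k + 1 ≤ k * k := by
    calc (k : ℝ) * k + 1 = if Gc t i j then α t else 0 := by simp [htij, α]
      _ ≤ ∑ r ∈ S₁, if Gc r i j then α r else 0 :=
        Finset.single_le_sum (f := fun r => if Gc r i j then α r else 0)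
          (fun r _ => by split_ifs; exacts [(hα r).le, le_rfl]) ht₁
      _ = ∑ r ∈ S₂, if Gc r i j then γ r else 0 := hentry i j (hne t i j htij)
      _ ≤ ∑ r ∈ S₂, (k : ℝ) := Finset.sum_le_sum fun r hr => by
        split_ifs
        exacts [hγle r hr, Nat.cast_nonneg k]
      _ ≤ k * k := by
        rw [Finset.sum_const, nsmul_eq_mul]
        exact mul_le_mul_of_nonneg_right (hcard S₂) (Nat.cast_nonneg k)
  linarith
end
end

section
/- Let G be a strongly connected simple directed graph on n > 1 vertices, let w ∈ Sp(V), let 𝒢_i ⊋ 𝒢_j be principal subsets of the set of cycles of G, and set 𝒢' := 𝒢_i − 𝒢_j. If L(𝒢_i) ⊋ L(𝒢_j) and Co(𝒢') ∩ L(𝒢_j) ≠ ∅, then 𝒢_i ≻ 𝒢_j, i.e. Co(𝒢_i) ⊋ Co(𝒢_j). -/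
open Matrix Finset
open scoped Classical

noncomputable section

theorem coOpen_subset_span {n k : ℕ} (C : Fin k → Matrix (Fin n) (Fin n) ℝ) (S : Finset (Fin k)) :
    coOpen C S ⊆ (Submodule.span ℝ (C '' (↑S : Set (Fin k))) : Set (Matrix (Fin n) (Fin n) ℝ)) := by
  rintro _ ⟨α, -, rfl⟩
  exact Submodule.sum_mem _ fun s hs =>
    Submodule.smul_mem _ _ (Submodule.subset_span ⟨s, hs, rfl⟩)

theorem span_le_of_coOpen_subset {n k : ℕ} {C : Fin k → Matrix (Fin n) (Fin n) ℝ}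
    {S : Finset (Fin k)} {L : Submodule ℝ (Matrix (Fin n) (Fin n) ℝ)}
    (h : coOpen C S ⊆ (L : Set (Matrix (Fin n) (Fin n) ℝ))) :
    Submodule.span ℝ (C '' (↑S : Set (Fin k))) ≤ L := by
  rw [Submodule.span_le]
  rintro _ ⟨t, ht, rfl⟩
  have h₁ : ∑ s ∈ S, (1 : ℝ) • C s ∈ L := h ⟨fun _ => 1, fun _ _ => one_pos, rfl⟩
  have h₂ : ∑ s ∈ S, (1 + if s = t then (1 : ℝ) else 0) • C s ∈ L :=
    h ⟨_, fun s _ => by split_ifs <;> norm_num, rfl⟩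
  have hsum : ∑ s ∈ S, (1 + if s = t then (1 : ℝ) else 0) • C s =
      ∑ s ∈ S, (1 : ℝ) • C s + C t := by
    simp only [add_smul, Finset.sum_add_distrib, ite_smul, one_smul, zero_smul]
    rw [Finset.sum_ite_eq', if_pos (Finset.mem_coe.mp ht)]
  rw [hsum] at h₂
  exact (L.add_mem_iff_right h₁).mp h₂

theorem exists_pos_forall_mul_lt {ι : Type*} (S : Finset ι) (β γ : ι → ℝ)
    (hγ : ∀ s ∈ S, 0 < γ s) : ∃ ε : ℝ, 0 < ε ∧ ∀ s ∈ S, ε * β s < γ s := by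
  have h : ∀ᶠ ε in nhdsWithin (0 : ℝ) (Set.Ioi 0), ∀ s ∈ S, ε * β s < γ s := by
    refine (Filter.eventually_all_finset S).mpr fun s hs => ?_
    have hc : Filter.Tendsto (fun ε : ℝ => ε * β s) (nhdsWithin 0 (Set.Ioi 0)) (nhds (0 * β s)) :=
      ((continuous_id.mul continuous_const).tendsto 0).mono_left nhdsWithin_le_nhds
    rw [zero_mul] at hc
    exact hc.eventually_lt_const (hγ s hs)
  obtain ⟨ε, hlt, hε⟩ := (h.and self_mem_nhdsWithin).exists
  exact ⟨ε, hε, hlt⟩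

theorem coOpen_subset_of_meets {n k : ℕ} {C : Fin k → Matrix (Fin n) (Fin n) ℝ}
    {S T : Finset (Fin k)} (hTS : T ⊆ S)
    (hmeet : (coOpen C (S \ T) ∩
      (Submodule.span ℝ (C '' (↑T : Set (Fin k))) : Set (Matrix (Fin n) (Fin n) ℝ))).Nonempty) :
    coOpen C T ⊆ coOpen C S := by
  obtain ⟨_, ⟨α, hα, rfl⟩, hX⟩ := hmeet
  obtain ⟨β, hβ⟩ := (Submodule.mem_span_image_finset_iff_exists_fun' ℝ).mp hX
  rintro _ ⟨γ, hγ, rfl⟩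
  obtain ⟨ε, hε, hlt⟩ := exists_pos_forall_mul_lt T β γ hγ
  refine ⟨fun s => if s ∈ T then γ s - ε * β s else ε * α s, fun s hs => ?_, ?_⟩
  · by_cases hsT : s ∈ T
    · simpa [hsT] using hlt s hsT
    · simpa [hsT] using mul_pos hε (hα s (Finset.mem_sdiff.mpr ⟨hs, hsT⟩))
  · rw [← Finset.sum_sdiff hTS]
    have h₁ : ∑ s ∈ S \ T, (if s ∈ T then γ s - ε * β s else ε * α s) • C s =
        ε • ∑ s ∈ S \ T, α s • C s := by
      rw [Finset.smul_sum]
      refine Finset.sum_congr rfl fun s hs => ?_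
      rw [if_neg (Finset.mem_sdiff.mp hs).2, mul_smul]
    have h₂ : ∑ s ∈ T, (if s ∈ T then γ s - ε * β s else ε * α s) • C s =
        ∑ s ∈ T, γ s • C s - ε • ∑ s ∈ T, β s • C s := by
      rw [Finset.smul_sum, ← Finset.sum_sub_distrib]
      refine Finset.sum_congr rfl fun s hs => ?_
      rw [if_pos hs, sub_smul, mul_smul]
    rw [h₁, h₂, hβ, add_sub_cancel]

/-- Lemma 5, case 2: for principal subsets with `𝒢_j ⊊ 𝒢_i`, if `L(𝒢_j) ⊊ L(𝒢_i)`
and `Co(𝒢_i − 𝒢_j)` meets `L(𝒢_j)`, then `Co(𝒢_j) ⊊ Co(𝒢_i)`, i.e. `𝒢_i ≻ 𝒢_j`. -/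
theorem coOpen_ssubset_of_span_lt_of_meets
    (n k : ℕ) (hn : 1 < n)
    (E : Fin n → Fin n → Prop) (hsimple : ∀ i, ¬ E i i)
    (hsc : ∀ i j : Fin n, Relation.ReflTransGen E i j)
    (w : Fin n → ℝ) (hw : ∀ i, 0 < w i) (hw1 : ∑ i, w i = 1)
    (Gc : Fin k → Fin n → Fin n → Prop)
    (hcyc : ∀ t, IsCycleOf E (Gc t)) (hinj : Function.Injective Gc)
    (hall : ∀ c, IsCycleOf E c → ∃ t, Gc t = c)
    (S₁ S₂ : Finset (Fin k))
    (hS₁ : PrincipalSubset Gc S₁) (hS₂ : PrincipalSubset Gc S₂)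
    (hss : S₂ ⊂ S₁)
    (hspan : Submodule.span ℝ ((fun t => cycleISM w (Gc t)) '' (↑S₂ : Set (Fin k))) <
      Submodule.span ℝ ((fun t => cycleISM w (Gc t)) '' (↑S₁ : Set (Fin k))))
    (hmeet : (coOpen (fun t => cycleISM w (Gc t)) (S₁ \ S₂) ∩
        (Submodule.span ℝ ((fun t => cycleISM w (Gc t)) '' (↑S₂ : Set (Fin k))) :
          Set (Matrix (Fin n) (Fin n) ℝ))).Nonempty) :
    coOpen (fun t => cycleISM w (Gc t)) S₂ ⊂ coOpen (fun t => cycleISM w (Gc t)) S₁ := by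
  exact ⟨coOpen_subset_of_meets hss.subset hmeet, fun h =>
    hspan.not_ge (span_le_of_coOpen_subset (h.trans (coOpen_subset_span _ _)))⟩
end
end

section
/- Let G be a strongly connected simple directed graph on n vertices and let w ∈ Sp(V). Then 𝔸_G(w) is a nonempty convex subset of the space of n×n real matrices, and its closure equals Â_G(w) = {A ∈ 𝔸_G : Aᵀ w = 0}. -/
open Matrix Finset
open scoped Classical

noncomputable section

section

variable {n : ℕ} {E : Fin n → Fin n → Prop} {w : Fin n → ℝ} {A B : Matrix (Fin n) (Fin n) ℝ}

/-- The Dirichlet form of an infinitesimal stochastic matrix with invariant vector `w`. -/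
lemma IsISM.sum_mul_sq_sub (hA : IsISM A) (hAw : Aᵀ *ᵥ w = 0) (f : Fin n → ℝ) :
    ∑ i, ∑ j, w i * A i j * (f i - f j) ^ 2 = -2 * ∑ i, w i * f i * (A *ᵥ f) i := by
  have h1 : ∑ i, ∑ j, w i * f i ^ 2 * A i j = 0 := by
    simp [← Finset.mul_sum, hA.2]
  have h2 : ∑ i, ∑ j, w i * A i j * f j ^ 2 = 0 := by
    rw [Finset.sum_comm]
    refine Finset.sum_eq_zero fun j _ => ?_
    have := congrFun hAw j
    simp only [mulVec, dotProduct, transpose_apply, Pi.zero_apply] at this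
    rw [← Finset.sum_mul]
    simp [mul_comm (w _), this]
  have h3 : ∑ i, w i * f i * (A *ᵥ f) i = ∑ i, ∑ j, w i * f i * (A i j * f j) := by
    simp [mulVec, dotProduct, Finset.mul_sum]
  rw [h3, ← add_zero (-2 * _), ← h1, ← add_zero (_ + _), ← h2]
  simp only [Finset.mul_sum, ← Finset.sum_add_distrib]
  exact Finset.sum_congr rfl fun i _ => Finset.sum_congr rfl fun j _ => by ring

lemma IsISM.mulVec_eq_zero_iff (hw : ∀ i, 0 < w i) (hA : IsISM A) (hAw : Aᵀ *ᵥ w = 0)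
    (f : Fin n → ℝ) : A *ᵥ f = 0 ↔ ∀ i j, A i j * (f i - f j) = 0 := by
  constructor
  · intro h i j
    have hnonneg : ∀ i j, 0 ≤ w i * A i j * (f i - f j) ^ 2 := by
      intro i j
      rcases eq_or_ne i j with rfl | hij
      · simp
      · have := hA.1 i j hij
        have := hw i
        positivity
    have hsum := hA.sum_mul_sq_sub hAw f
    simp only [h, Pi.zero_apply, mul_zero, Finset.sum_const_zero] at hsum
    have hi := (Finset.sum_eq_zero_iff_of_nonneg
      (fun i _ => Finset.sum_nonneg fun j _ => hnonneg i j)).1 hsum i (Finset.mem_univ i)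
    have hij := (Finset.sum_eq_zero_iff_of_nonneg
      (fun j _ => hnonneg i j)).1 hi j (Finset.mem_univ j)
    simpa [(hw i).ne'] using hij
  · intro h
    ext i
    have h1 : ∑ j, A i j * (f i - f j) = 0 := Finset.sum_eq_zero fun j _ => h i j
    simp only [mul_sub, Finset.sum_sub_distrib, ← Finset.sum_mul, hA.2 i] at h1
    simp only [mulVec, dotProduct, Pi.zero_apply]
    linarith

lemma IsISM.mulVec_eq_zero_of_mulVec_mulVec (hw : ∀ i, 0 < w i) (hA : IsISM A)
    (hAw : Aᵀ *ᵥ w = 0) {f : Fin n → ℝ} (hf : A *ᵥ (A *ᵥ f) = 0) : A *ᵥ f = 0 := by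
  set g := A *ᵥ f with hg
  have hker := (hA.mulVec_eq_zero_iff hw hAw g).1 hf
  have hadj : ∀ j, ∑ i, w i * g i * A i j = 0 := by
    intro j
    have := congrFun hAw j
    simp only [mulVec, dotProduct, transpose_apply, Pi.zero_apply] at this
    calc ∑ i, w i * g i * A i j = ∑ i, g j * (A i j * w i) :=
          Finset.sum_congr rfl fun i _ => by linear_combination w i * hker i j
      _ = 0 := by rw [← Finset.mul_sum, this, mul_zero]
  have hsum : ∑ i, w i * g i ^ 2 = 0 := by
    calc ∑ i, w i * g i ^ 2 = ∑ i, ∑ j, w i * g i * A i j * f j := by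
          refine Finset.sum_congr rfl fun i _ => ?_
          have hgi : g i = ∑ j, A i j * f j := rfl
          simp only [mul_assoc]
          rw [← Finset.mul_sum, ← Finset.mul_sum, ← hgi]
          ring
      _ = 0 := by
          rw [Finset.sum_comm]
          simp [← Finset.sum_mul, hadj]
  ext i
  have hi := (Finset.sum_eq_zero_iff_of_nonneg
    (fun i _ => mul_nonneg (hw i).le (sq_nonneg (g i)))).1 hsum i (Finset.mem_univ i)
  simpa [(hw i).ne'] using hi

lemma IsISM.rootMultiplicity_charpoly (hw : ∀ i, 0 < w i) (hA : IsISM A) (hAw : Aᵀ *ᵥ w = 0) :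
    A.charpoly.rootMultiplicity 0 = Module.finrank ℝ (LinearMap.ker A.toLin') := by
  have hpow : ∀ (k : ℕ) (f : Fin n → ℝ), (A.toLin' ^ k) f = 0 → A *ᵥ f = 0 := by
    intro k
    induction k with
    | zero => intro f hf; simp_all
    | succ k ih =>
      intro f hf
      exact hA.mulVec_eq_zero_of_mulVec_mulVec hw hAw (ih _ (by simpa [pow_succ] using hf))
  have hker : Module.End.maxGenEigenspace A.toLin' 0 = LinearMap.ker A.toLin' := by
    ext f
    simp only [Module.End.mem_maxGenEigenspace, zero_smul, sub_zero, LinearMap.mem_ker]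
    exact ⟨fun ⟨k, hk⟩ => hpow k f hk, fun h => ⟨1, by simpa using h⟩⟩
  rw [← hker, LinearMap.finrank_maxGenEigenspace_eq, Matrix.charpoly_toLin']

/-- Zero is a simple eigenvalue exactly when the only harmonic functions are constant. -/
lemma IsISM.simpleZeroEig_iff (hn : 1 ≤ n) (hw : ∀ i, 0 < w i) (hA : IsISM A)
    (hAw : Aᵀ *ᵥ w = 0) :
    SimpleZeroEig A ↔
      ∀ f : Fin n → ℝ, (∀ i j, A i j * (f i - f j) = 0) → ∀ i j, f i = f j := by
  have : Nonempty (Fin n) := ⟨⟨0, hn⟩⟩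
  have hone : A *ᵥ (1 : Fin n → ℝ) = 0 :=
    (hA.mulVec_eq_zero_iff hw hAw 1).2 (by simp)
  simp only [← hA.mulVec_eq_zero_iff hw hAw]
  rw [SimpleZeroEig, hA.rootMultiplicity_charpoly hw hAw,
    finrank_eq_one_iff_of_nonzero' (⟨1, hone⟩ : LinearMap.ker A.toLin')
      fun h => one_ne_zero (congrArg Subtype.val h)]
  constructor
  · intro h f hf i j
    obtain ⟨c, hc⟩ := h ⟨f, hf⟩
    have hc' : c • (1 : Fin n → ℝ) = f := congrArg Subtype.val hc
    simp [← hc']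
  · rintro h ⟨f, hf⟩
    refine ⟨f (Classical.arbitrary _), Subtype.ext (funext fun i => ?_)⟩
    simpa using h f hf _ _

/-- A conic combination with a positive coefficient at a feasible matrix is feasible. -/
lemma Feasible.smul_add_smul (hn : 1 ≤ n) (hw : ∀ i, 0 < w i) (hA : Feasible E w A)
    (hB : IsISM B ∧ InPattern E B ∧ Bᵀ *ᵥ w = 0) {a b : ℝ} (ha : 0 < a) (hb : 0 ≤ b) :
    Feasible E w (a • A + b • B) := by
  obtain ⟨hA1, hA2, hA3, hA4⟩ := hA
  obtain ⟨hB1, hB2, hB4⟩ := hB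
  have hC1 : IsISM (a • A + b • B) := by
    refine ⟨fun i j hij => ?_, fun i => ?_⟩
    · have := hA1.1 i j hij
      have := hB1.1 i j hij
      simp only [Matrix.add_apply, Matrix.smul_apply, smul_eq_mul]
      positivity
    · simp [Finset.sum_add_distrib, ← Finset.mul_sum, hA1.2 i, hB1.2 i]
  have hC4 : (a • A + b • B)ᵀ *ᵥ w = 0 := by
    simp [Matrix.add_mulVec, Matrix.smul_mulVec, hA4, hB4]
  refine ⟨hC1, fun i j hij hE => by simp [hA2 i j hij hE, hB2 i j hij hE], ?_, hC4⟩
  rw [hC1.simpleZeroEig_iff hn hw hC4]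
  refine fun f hf => (hA1.simpleZeroEig_iff hn hw hA4).1 hA3 f fun i j => ?_
  rcases eq_or_ne i j with rfl | hij
  · simp
  have hA' := hA1.1 i j hij
  have hB' := hB1.1 i j hij
  rcases mul_eq_zero.1 (hf i j) with h | h
  · simp only [Matrix.add_apply, Matrix.smul_apply, smul_eq_mul] at h
    have h1 : a * A i j = 0 := by nlinarith [mul_nonneg ha.le hA', mul_nonneg hb hB']
    simp [(mul_eq_zero.1 h1).resolve_left ha.ne']
  · simp [h]

/-- Along a directed path there is a nonnegative unit flow from its start to its end. -/
lemma exists_unit_flow {i j : Fin n} (h : Relation.ReflTransGen E i j) :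
    ∃ F : Fin n → Fin n → ℝ, (∀ a b, 0 ≤ F a b) ∧ (∀ a b, ¬ E a b → F a b = 0) ∧
      ∀ v, ∑ b, F v b - ∑ a, F a v = (if v = i then 1 else 0) - (if v = j then 1 else 0) := by
  induction h with
  | refl => exact ⟨fun _ _ => 0, by simp, by simp, by simp⟩
  | @tail c d _ hcd ih =>
    obtain ⟨F, hF0, hFE, hF⟩ := ih
    refine ⟨fun a b => F a b + (if a = c then 1 else 0) * (if b = d then 1 else 0),
      fun a b => add_nonneg (hF0 a b) (by positivity), fun a b hab => ?_, fun v => ?_⟩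
    · simp only [hFE a b hab, zero_add]
      split_ifs <;> simp_all
    · have := hF v
      simp only [Finset.sum_add_distrib, ← Finset.mul_sum, ← Finset.sum_mul,
        Finset.sum_ite_eq', Finset.mem_univ, if_true]
      linarith

/-- A strongly connected digraph carries a circulation that is positive on every edge. -/
lemma exists_positive_circulation (hsc : ∀ i j : Fin n, Relation.ReflTransGen E i j) :
    ∃ C : Fin n → Fin n → ℝ, (∀ a b, 0 ≤ C a b) ∧ (∀ a b, ¬ E a b → C a b = 0) ∧
      (∀ a b, E a b → 0 < C a b) ∧ ∀ v, ∑ b, C v b = ∑ a, C a v := by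
  have hcycle : ∀ e : Fin n × Fin n, ∃ C : Fin n → Fin n → ℝ, (∀ a b, 0 ≤ C a b) ∧
      (∀ a b, ¬ E a b → C a b = 0) ∧ (E e.1 e.2 → 0 < C e.1 e.2) ∧
      ∀ v, ∑ b, C v b = ∑ a, C a v := by
    rintro ⟨i, j⟩
    by_cases hE : E i j
    · obtain ⟨F, hF0, hFE, hF⟩ := exists_unit_flow (hsc j i)
      refine ⟨fun a b => F a b + (if a = i then 1 else 0) * (if b = j then 1 else 0),
        fun a b => add_nonneg (hF0 a b) (by positivity), fun a b hab => ?_, fun _ => ?_,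
        fun v => ?_⟩
      · simp only [hFE a b hab, zero_add]
        split_ifs <;> simp_all
      · have := hF0 i j
        simp only [if_true]
        linarith
      · have := hF v
        simp only [Finset.sum_add_distrib, ← Finset.mul_sum, ← Finset.sum_mul,
          Finset.sum_ite_eq', Finset.mem_univ, if_true]
        linarith
    · exact ⟨fun _ _ => 0, by simp, by simp, fun h => absurd h hE, by simp⟩
  choose C hC0 hCE hCpos hC using hcycle
  refine ⟨fun a b => ∑ e, C e a b, fun a b => Finset.sum_nonneg fun e _ => hC0 e a b,
    fun a b hab => Finset.sum_eq_zero fun e _ => hCE e a b hab, fun a b hab => ?_, fun v => ?_⟩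
  · exact Finset.sum_pos' (fun e _ => hC0 e a b) ⟨(a, b), Finset.mem_univ _, hCpos (a, b) hab⟩
  · rw [Finset.sum_comm, Finset.sum_comm (f := fun a e => C e a v)]
    exact Finset.sum_congr rfl fun e _ => hC e v

lemma exists_feasible (hn : 1 ≤ n) (hsimple : ∀ i, ¬ E i i)
    (hsc : ∀ i j : Fin n, Relation.ReflTransGen E i j) (hw : ∀ i, 0 < w i) :
    ∃ A, Feasible E w A := by
  obtain ⟨C, hC0, hCE, hCpos, hC⟩ := exists_positive_circulation hsc
  let A : Matrix (Fin n) (Fin n) ℝ :=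
    Matrix.of fun i j => (C i j - if i = j then ∑ k, C i k else 0) / w i
  have hoff : ∀ i j, i ≠ j → A i j = C i j / w i := fun i j hij => by simp [A, hij]
  have hA1 : IsISM A := by
    refine ⟨fun i j hij => ?_, fun i => ?_⟩
    · rw [hoff i j hij]
      exact div_nonneg (hC0 i j) (hw i).le
    · simp [A, ← Finset.sum_div]
  have hA4 : Aᵀ *ᵥ w = 0 := by
    ext j
    have h : ∀ i, A i j * w i = C i j - if i = j then ∑ k, C i k else 0 := fun i => by
      simp only [A, Matrix.of_apply]
      exact div_mul_cancel₀ _ (hw i).ne'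
    simp [mulVec, dotProduct, h, hC j]
  refine ⟨A, hA1, fun i j hij hE => by simp [hoff i j hij, hCE i j hE], ?_, hA4⟩
  rw [hA1.simpleZeroEig_iff hn hw hA4]
  intro f hf i j
  have hedge : ∀ a b, E a b → f a = f b := by
    intro a b hab
    have hne : a ≠ b := by rintro rfl; exact hsimple a hab
    have hpos : 0 < A a b := by
      rw [hoff a b hne]
      exact div_pos (hCpos a b hab) (hw a)
    exact sub_eq_zero.1 ((mul_eq_zero.1 (hf a b)).resolve_left hpos.ne')
  induction hsc i j with
  | refl => rfl
  | tail _ hbc ih => exact ih.trans (hedge _ _ hbc)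

lemma isClosed_setOf_isISM_inPattern_mulVec (E : Fin n → Fin n → Prop) (w : Fin n → ℝ) :
    IsClosed {A : Matrix (Fin n) (Fin n) ℝ | IsISM A ∧ InPattern E A ∧ Aᵀ *ᵥ w = 0} := by
  have hentry : ∀ i j, Continuous fun A : Matrix (Fin n) (Fin n) ℝ => A i j :=
    fun i j => continuous_id.matrix_elem i j
  simp only [IsISM, InPattern, Set.ofPred_and, Set.ofPred_forall]
  refine IsClosed.inter (IsClosed.inter ?_ ?_) (IsClosed.inter ?_ ?_)
  · exact isClosed_iInter fun i => isClosed_iInter fun j => isClosed_iInter fun _ =>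
      isClosed_le continuous_const (hentry i j)
  · exact isClosed_iInter fun i =>
      isClosed_eq (continuous_finsetSum _ fun j _ => hentry i j) continuous_const
  · exact isClosed_iInter fun i => isClosed_iInter fun j => isClosed_iInter fun _ =>
      isClosed_iInter fun _ => isClosed_eq (hentry i j) continuous_const
  · exact isClosed_eq (continuous_id.matrix_transpose.matrix_mulVec continuous_const)
      continuous_const

end

/-- Proposition 5: for `G` strongly connected and `w` in the interior of the simplex,
`𝔸_G(w)` is nonempty and convex, and its closure is `Â_G(w)`. -/
theorem feasible_nonempty_convex_closure
    (n : ℕ) (hn : 1 ≤ n) (E : Fin n → Fin n → Prop) (hsimple : ∀ i, ¬ E i i)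
    (hsc : ∀ i j : Fin n, Relation.ReflTransGen E i j)
    (w : Fin n → ℝ) (hw : ∀ i, 0 < w i) (hw1 : ∑ i, w i = 1) :
    ({A : Matrix (Fin n) (Fin n) ℝ | Feasible E w A}).Nonempty ∧
      Convex ℝ {A : Matrix (Fin n) (Fin n) ℝ | Feasible E w A} ∧
      closure {A : Matrix (Fin n) (Fin n) ℝ | Feasible E w A} =
        {A : Matrix (Fin n) (Fin n) ℝ | IsISM A ∧ InPattern E A ∧ Aᵀ *ᵥ w = 0} := by
  obtain ⟨A₀, hA₀⟩ := exists_feasible hn hsimple hsc hw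
  refine ⟨⟨A₀, hA₀⟩, ?_, ?_⟩
  · intro A hA B hB a b ha hb hab
    rcases ha.eq_or_lt with rfl | ha
    · obtain rfl : b = 1 := by linarith
      simpa using hB
    · exact hA.smul_add_smul hn hw ⟨hB.1, hB.2.1, hB.2.2.2⟩ ha hb
  · refine Set.Subset.antisymm (closure_minimal ?_ (isClosed_setOf_isISM_inPattern_mulVec E w))
      fun B hB => ?_
    · exact fun A hA => ⟨hA.1, hA.2.1, hA.2.2.2⟩
    have hlim : Filter.Tendsto (fun k : ℕ => (1 / ((k : ℝ) + 1)) • A₀ + (1 : ℝ) • B)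
        Filter.atTop (nhds B) := by
      simpa using ((tendsto_one_div_add_atTop_nhds_zero_nat (𝕜 := ℝ)).smul_const A₀).add_const
        ((1 : ℝ) • B)
    exact mem_closure_of_tendsto hlim
      (Filter.Eventually.of_forall fun k => hA₀.smul_add_smul hn hw hB (by positivity) one_pos.le)
end
end

section
/- Let G be a rooted simple directed graph on n vertices, let w ∈ Sp[V] be such that 𝔸_G(w) is nonempty, and let A ∈ 𝔸_G(w). Then the digraph G_A induced by A (with an edge i→j exactly when i ≠ j and A_{ij} > 0) is rooted, and its root set is exactly V_w = {i ∈ V : w_i ≠ 0}. -/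
open Matrix Finset
open scoped Classical

noncomputable section

/-- If `0` is a simple eigenvalue of `A`, the left kernel of `A` is spanned by any of its nonzero
elements. -/
lemma SimpleZeroEig.exists_smul_eq {n : ℕ} {A : Matrix (Fin n) (Fin n) ℝ} (hA : SimpleZeroEig A)
    {w v : Fin n → ℝ} (hw : w ≠ 0) (hAw : w ᵥ* A = 0) (hAv : v ᵥ* A = 0) :
    ∃ c : ℝ, c • w = v := by
  have hrank : Module.finrank ℝ (Module.End.eigenspace (Matrix.toLin' Aᵀ) 0) ≤ 1 := by
    have h := LinearMap.finrank_eigenspace_le (Matrix.toLin' Aᵀ) (0 : ℝ)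
    rwa [Matrix.charpoly_toLin', Matrix.charpoly_transpose, hA] at h
  have hmem : ∀ u : Fin n → ℝ, u ᵥ* A = 0 → u ∈ Module.End.eigenspace (Matrix.toLin' Aᵀ) 0 := by
    intro u hu
    simpa [Module.End.mem_eigenspace_iff, Matrix.mulVec_transpose] using hu
  obtain ⟨u, hu⟩ := finrank_le_one_iff.mp hrank
  obtain ⟨a, ha⟩ := hu ⟨w, hmem w hAw⟩
  obtain ⟨b, hb⟩ := hu ⟨v, hmem v hAv⟩
  have ha' : a • (u : Fin n → ℝ) = w := congrArg Subtype.val ha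
  have hb' : b • (u : Fin n → ℝ) = v := congrArg Subtype.val hb
  have ha0 : a ≠ 0 := by
    rintro rfl
    exact hw (by simpa using ha'.symm)
  refine ⟨b / a, ?_⟩
  rw [← ha', ← hb', smul_smul, div_mul_cancel₀ b ha0]

/-- A nonempty set of indices which no nonzero entry of `A` leaves supports a nonzero vector of the
left kernel of `A`, provided the rows of `A` sum to zero. -/
lemma exists_vecMul_eq_zero_of_closed {n : ℕ} {A : Matrix (Fin n) (Fin n) ℝ}
    (hrow : ∀ i, ∑ j, A i j = 0) {C : Set (Fin n)} (hC : C.Nonempty)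
    (hclosed : ∀ i ∈ C, ∀ j ∉ C, A i j = 0) :
    ∃ v : Fin n → ℝ, v ≠ 0 ∧ (∀ i ∉ C, v i = 0) ∧ v ᵥ* A = 0 := by
  let B : Matrix C C ℝ := A.submatrix (↑) (↑)
  have sum_C : ∀ f : Fin n → ℝ, (∀ i ∉ C, f i = 0) → ∑ i : C, f i = ∑ i, f i := by
    intro f hf
    rw [← Finset.sum_subtype (Finset.univ.filter (· ∈ C)) (by simp) f]
    exact Finset.sum_subset (Finset.subset_univ _) fun i _ hi => hf i (by simpa using hi)
  have hdet : B.det = 0 := by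
    obtain ⟨i, hi⟩ := hC
    refine Matrix.exists_mulVec_eq_zero_iff.mp ⟨fun _ => 1, fun h => ?_, ?_⟩
    · simpa using congrFun h ⟨i, hi⟩
    · ext k
      simpa [B, Matrix.mulVec, dotProduct, hrow] using sum_C (A k) (hclosed k k.2)
  obtain ⟨u, hu0, hu⟩ := Matrix.exists_vecMul_eq_zero_iff.mpr hdet
  let v : Fin n → ℝ := fun i => if h : i ∈ C then u ⟨i, h⟩ else 0
  have hvu : ∀ i : C, v i = u i := fun i => by simp [v]
  have hvC : ∀ i ∉ C, v i = 0 := fun i hi => by simp [v, hi]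
  refine ⟨v, fun h => hu0 ?_, hvC, ?_⟩
  · ext i
    rw [← hvu, h]
    rfl
  · ext j
    have hsum := sum_C (fun i => v i * A i j) fun i hi => by rw [hvC i hi, zero_mul]
    simp only [hvu] at hsum
    rw [Matrix.vecMul, dotProduct, ← hsum]
    by_cases hj : j ∈ C
    · exact congrFun hu ⟨j, hj⟩
    · exact Finset.sum_eq_zero fun i _ => by rw [hclosed i i.2 j hj, mul_zero]

/-- The support of a nonnegative left null vector of an ISM is closed under taking successors. -/
lemma IsISM.pos_of_edge {n : ℕ} {A : Matrix (Fin n) (Fin n) ℝ} (hA : IsISM A) {w : Fin n → ℝ}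
    (hw : ∀ i, 0 ≤ w i) (hAw : w ᵥ* A = 0) {i j : Fin n} (hi : w i ≠ 0)
    (hAij : 0 < A i j) : w j ≠ 0 := by
  intro hj
  have hsum : ∑ k, w k * A k j = 0 := congrFun hAw j
  have hnonneg : ∀ k ∈ Finset.univ, 0 ≤ w k * A k j := by
    intro k _
    by_cases hk : k = j
    · rw [hk, hj, zero_mul]
    · exact mul_nonneg (hw k) (hA.1 k j hk)
  exact mul_ne_zero hi hAij.ne' ((Finset.sum_eq_zero_iff_of_nonneg hnonneg).mp hsum i (by simp))

/-- Corollary 3, part 1: for any `A ∈ 𝔸_G(w)`, the digraph `G_A` induced by `A`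
is rooted, and its root set is exactly the support of `w`. -/
theorem induced_digraph_rooted_with_root_set_support
    (n : ℕ) (hn : 1 ≤ n) (E : Fin n → Fin n → Prop) (hsimple : ∀ i, ¬ E i i)
    (hrooted : Rooted E) (w : Fin n → ℝ) (hw : MemSimplex w)
    (A : Matrix (Fin n) (Fin n) ℝ) (hA : Feasible E w A) :
    Rooted (fun i j : Fin n => i ≠ j ∧ 0 < A i j) ∧
      ∀ r : Fin n, IsRootOf (fun i j : Fin n => i ≠ j ∧ 0 < A i j) r ↔ w r ≠ 0 := by
  obtain ⟨hISM, -, hsimp, hAw⟩ := hA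
  rw [Matrix.mulVec_transpose] at hAw
  obtain ⟨i₀, hi₀⟩ : ∃ i, w i ≠ 0 := by
    by_contra! h
    simpa [h] using hw.2
  have hw0 : w ≠ 0 := fun h => hi₀ (congrFun h i₀)
  have isRoot_of_ne : ∀ r, w r ≠ 0 → IsRootOf (fun i j : Fin n => i ≠ j ∧ 0 < A i j) r := by
    intro r hr
    by_contra hroot
    let C : Set (Fin n) := {i | ¬ Relation.ReflTransGen (fun i j => i ≠ j ∧ 0 < A i j) i r}
    have hrC : r ∉ C := fun h => h Relation.ReflTransGen.refl
    have hclosed : ∀ i ∈ C, ∀ j ∉ C, A i j = 0 := by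
      intro i hi j hj
      have hij : i ≠ j := fun h => hj (h ▸ hi)
      refine le_antisymm (not_lt.mp fun hpos => hi ?_) (hISM.1 i j hij)
      exact Relation.ReflTransGen.head ⟨hij, hpos⟩ (not_not.mp hj)
    obtain ⟨v, hv0, hvC, hv⟩ :=
      exists_vecMul_eq_zero_of_closed hISM.2 (C := C) (not_forall.mp hroot) hclosed
    obtain ⟨c, rfl⟩ := hsimp.exists_smul_eq hw0 hAw hv
    have hc : c = 0 := (mul_eq_zero.mp (hvC r hrC)).resolve_right hr
    exact hv0 (by rw [hc, zero_smul])
  refine ⟨⟨i₀, isRoot_of_ne i₀ hi₀⟩, fun r => ⟨fun hr => ?_, isRoot_of_ne r⟩⟩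
  have hpath := hr i₀
  clear hr
  induction hpath with
  | refl => exact hi₀
  | tail _ hstep ih => exact hISM.pos_of_edge hw.1 hAw ih hstep.2
end
end

section
/- Let G be a rooted simple directed graph on n vertices, let w ∈ Sp[V], and let A ∈ 𝔸_G(w). Then the matrix exponential exp(tA) converges, as t → ∞, to the rank-one matrix 𝟏·wᵀ (the matrix whose every row is wᵀ). -/
open Matrix Finset
open scoped Classical

noncomputable section

/-- The matrix exponential, defined by its power series. -/
noncomputable def matExp {n : ℕ} (A : Matrix (Fin n) (Fin n) ℝ) : Matrix (Fin n) (Fin n) ℝ :=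
  ∑' m : ℕ, ((m.factorial : ℝ))⁻¹ • A ^ m

section BanachAlgebra

open Filter Topology

/-- In a complex Banach algebra, the powers of an element whose spectrum lies in the open unit
disc decay geometrically. -/
lemma exists_norm_pow_le_geometric {𝔸 : Type*} [NormedRing 𝔸] [NormedAlgebra ℂ 𝔸]
    [CompleteSpace 𝔸] [Nontrivial 𝔸] (a : 𝔸) (ha : ∀ z ∈ spectrum ℂ a, ‖z‖ < 1) :
    ∃ C r : ℝ, 0 ≤ r ∧ r < 1 ∧ ∀ k : ℕ, ‖a ^ k‖ ≤ C * r ^ k := by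
  have h1 : spectralRadius ℂ a < ((1 : NNReal) : ENNReal) :=
    spectrum.spectralRadius_lt_of_forall_lt a fun z hz => by
      exact_mod_cast ha z hz
  obtain ⟨r, hr, hr1⟩ := ENNReal.lt_iff_exists_nnreal_btwn.mp h1
  have hr0 : 0 < r := by exact_mod_cast pos_of_gt hr
  have hO : (fun k : ℕ => ‖a ^ k‖) =O[atTop] fun k => (r : ℝ) ^ k := by
    refine Asymptotics.IsBigO.of_bound 1 ?_
    filter_upwards [(spectrum.pow_norm_pow_one_div_tendsto_nhds_spectralRadius a).eventually_lt_const
      hr, eventually_ne_atTop 0] with k hk hk0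
    rw [ENNReal.ofReal_lt_coe_iff (by positivity)] at hk
    have h := pow_le_pow_left₀ (by positivity) hk.le k
    rw [one_div, Real.rpow_inv_natCast_pow (norm_nonneg _) hk0] at h
    simpa using h
  obtain ⟨C, hC⟩ := (Asymptotics.isBigO_nat_atTop_iff fun k hk =>
    absurd hk (by positivity)).mp hO
  exact ⟨C, r, r.2, by exact_mod_cast hr1, fun k => by simpa using hC k⟩

variable {𝔸 : Type*} [NormedRing 𝔸] [NormedAlgebra ℝ 𝔸]

lemma hasSum_real_exp (x : ℝ) :
    HasSum (fun k : ℕ => (k.factorial : ℝ)⁻¹ * x ^ k) (Real.exp x) := by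
  simpa [Real.exp_eq_exp_ℝ] using NormedSpace.exp_series_hasSum_exp' (𝕂 := ℝ) x

lemma norm_exp_smul_le_of_norm_pow_le {Q : 𝔸} {C r : ℝ} (hQ : ∀ k : ℕ, ‖Q ^ k‖ ≤ C * r ^ k)
    {s : ℝ} (hs : 0 ≤ s) : ‖NormedSpace.exp (s • Q)‖ ≤ C * Real.exp (s * r) := by
  rw [NormedSpace.exp_eq_tsum ℝ]
  refine tsum_of_norm_bounded ((hasSum_real_exp (s * r)).mul_left C) fun k => ?_
  rw [smul_pow, norm_smul, norm_smul, Real.norm_of_nonneg (by positivity),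
    Real.norm_of_nonneg (by positivity), mul_pow]
  calc _ ≤ (k.factorial : ℝ)⁻¹ * (s ^ k * (C * r ^ k)) := by gcongr; exact hQ k
    _ = _ := by ring

variable [CompleteSpace 𝔸]

/-- The exponential of `s • (Q + J)` for an idempotent `J` annihilated by `Q` on both sides. -/
lemma exp_smul_add_of_mul_eq_zero {Q J : 𝔸} (hQJ : Q * J = 0) (hJQ : J * Q = 0)
    (hJ : J * J = J) (s : ℝ) :
    NormedSpace.exp (s • (Q + J)) = NormedSpace.exp (s • Q) + (Real.exp s • J - J) := by
  have hpow : ∀ k : ℕ, (Q + J) ^ k = Q ^ k + (J - if k = 0 then J else 0) := by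
    intro k
    induction k with
    | zero => simp
    | succ k ih =>
      have h0 : Q ^ k * J = if k = 0 then J else 0 := by
        cases k with
        | zero => simp
        | succ k => simp [pow_succ, mul_assoc, hQJ]
      rw [pow_succ, ih]
      by_cases hk : k = 0
      · simp [hk]
      · simp only [hk, if_false] at h0
        simp [hk, mul_add, add_mul, pow_succ, hJQ, hJ, h0]
  have h1 := NormedSpace.exp_series_hasSum_exp' (𝕂 := ℝ) (s • (Q + J))
  have h2 := (NormedSpace.exp_series_hasSum_exp' (𝕂 := ℝ) (s • Q)).add
    (((hasSum_real_exp s).smul_const J).sub (hasSum_ite_eq (0 : ℕ) J))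
  refine h1.unique (h2.congr_fun ?_)
  intro k
  rw [smul_pow, hpow, smul_pow]
  by_cases hk : k = 0
  · simp [hk]
  · simp [hk, mul_smul]

lemma exp_smul_sub_one (P : 𝔸) (s : ℝ) :
    NormedSpace.exp (s • (P - 1)) = Real.exp (-s) • NormedSpace.exp (s • P) := by
  let : NormedAlgebra ℚ 𝔸 := NormedAlgebra.restrictScalars ℚ ℝ 𝔸
  have h : s • (P - 1) = algebraMap ℝ 𝔸 (-s) + s • P := by
    rw [Algebra.algebraMap_eq_smul_one, smul_sub, neg_smul]; abel
  rw [h, NormedSpace.exp_add_of_commute (Algebra.commutes _ _), ← NormedSpace.algebraMap_exp_comm,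
    Algebra.algebraMap_eq_smul_one, smul_one_mul, Real.exp_eq_exp_ℝ]

/-- If `Q` has geometrically decaying powers and annihilates the idempotent `J` on both sides,
then the semigroup generated by `Q + J - 1` converges to `J`. -/
lemma tendsto_exp_smul_add_sub_one {Q J : 𝔸} (hQJ : Q * J = 0) (hJQ : J * Q = 0)
    (hJ : J * J = J) {C r : ℝ} (hr : r < 1) (hQ : ∀ k : ℕ, ‖Q ^ k‖ ≤ C * r ^ k) :
    Tendsto (fun s : ℝ => NormedSpace.exp (s • (Q + J - 1))) atTop (𝓝 J) := by
  have h1 : Tendsto (fun s : ℝ => Real.exp (-s) • NormedSpace.exp (s • Q)) atTop (𝓝 0) := by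
    have hlim : Tendsto (fun s : ℝ => C * Real.exp (-((1 - r) * s))) atTop (𝓝 (C * 0)) :=
      (Real.tendsto_exp_neg_atTop_nhds_zero.comp
        (tendsto_id.const_mul_atTop (sub_pos.mpr hr))).const_mul C
    rw [mul_zero] at hlim
    refine squeeze_zero_norm' ?_ hlim
    filter_upwards [eventually_ge_atTop 0] with s hs
    rw [norm_smul, Real.norm_of_nonneg (Real.exp_pos _).le]
    calc _ ≤ Real.exp (-s) * (C * Real.exp (s * r)) := by
          gcongr; exact norm_exp_smul_le_of_norm_pow_le hQ hs
      _ = C * Real.exp (-((1 - r) * s)) := by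
          rw [mul_left_comm, ← Real.exp_add]; ring_nf
  have h2 : Tendsto (fun s : ℝ => J - Real.exp (-s) • J) atTop (𝓝 (J - (0 : ℝ) • J)) :=
    tendsto_const_nhds.sub (Real.tendsto_exp_neg_atTop_nhds_zero.smul_const J)
  have h3 := h1.add h2
  rw [zero_smul, sub_zero, zero_add] at h3
  refine h3.congr fun s => ?_
  rw [exp_smul_sub_one, exp_smul_add_of_mul_eq_zero hQJ hJQ hJ, smul_add, smul_sub, smul_smul,
    ← Real.exp_add, neg_add_cancel, Real.exp_zero, one_smul]

end BanachAlgebra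

section Spectrum

variable {n : ℕ} {A : Matrix (Fin n) (Fin n) ℝ} {w : Fin n → ℝ}

/-- If `0` is a simple eigenvalue of an ISM, its kernel consists of the constant vectors. -/
lemma exists_eq_const_of_mulVec_eq_zero (hA : IsISM A) (h0 : SimpleZeroEig A) (hn : 1 ≤ n)
    {v : Fin n → ℝ} (hv : A *ᵥ v = 0) : ∃ c : ℝ, v = fun _ => c := by
  have hrank : Module.finrank ℝ (Module.End.maxGenEigenspace (toLin' A) 0) = 1 := by
    rw [LinearMap.finrank_maxGenEigenspace_eq, Matrix.charpoly_toLin', h0]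
  have hmem : ∀ u : Fin n → ℝ, A *ᵥ u = 0 →
      u ∈ Module.End.maxGenEigenspace (toLin' A) 0 := fun u hu => by
    rw [Module.End.mem_maxGenEigenspace]
    exact ⟨1, by simpa using hu⟩
  have hone : A *ᵥ (fun _ => (1 : ℝ)) = 0 := by
    ext i
    simpa [mulVec, dotProduct] using hA.2 i
  have hne : (⟨fun _ => 1, hmem _ hone⟩ : Module.End.maxGenEigenspace (toLin' A) 0) ≠ 0 := by
    intro h
    simpa using congrFun (congrArg Subtype.val h) ⟨0, hn⟩
  obtain ⟨c, hc⟩ := (finrank_eq_one_iff_of_nonzero' _ hne).mp hrank ⟨v, hmem v hv⟩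
  exact ⟨c, by simpa [funext_iff, eq_comm] using congrArg Subtype.val hc⟩

/-- A complex kernel vector of an ISM with simple eigenvalue `0` that is annihilated by the
left kernel vector `w` vanishes. -/
lemma eq_zero_of_mulVec_map_ofReal_eq_zero (hA : IsISM A) (h0 : SimpleZeroEig A) (hn : 1 ≤ n)
    (hw : ∑ i, w i = 1) {v : Fin n → ℂ} (hv : A.map Complex.ofReal *ᵥ v = 0)
    (hwv : ∑ i, (w i : ℂ) * v i = 0) : v = 0 := by
  have key : ∀ u : Fin n → ℝ, A *ᵥ u = 0 → ∑ i, w i * u i = 0 → u = 0 := by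
    intro u hu hwu
    obtain ⟨c, rfl⟩ := exists_eq_const_of_mulVec_eq_zero hA h0 hn hu
    rw [← Finset.sum_mul, hw, one_mul] at hwu
    subst hwu
    rfl
  have hre := key (fun i => (v i).re)
    (by ext i; simpa [mulVec, dotProduct] using congrArg Complex.re (congrFun hv i))
    (by simpa using congrArg Complex.re hwv)
  have him := key (fun i => (v i).im)
    (by ext i; simpa [mulVec, dotProduct] using congrArg Complex.im (congrFun hv i))
    (by simpa using congrArg Complex.im hwv)
  ext i
  exact Complex.ext (congrFun hre i) (congrFun him i)

lemma IsISM.diag_nonpos (hA : IsISM A) (i : Fin n) : A i i ≤ 0 := by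
  have h := hA.2 i
  rw [← Finset.add_sum_erase _ _ (Finset.mem_univ i)] at h
  have := Finset.sum_nonneg fun j (hj : j ∈ Finset.univ.erase i) =>
    hA.1 i j (Finset.ne_of_mem_erase hj).symm
  linarith

/-- The only complex number of modulus at least one in the closed disc of centre `p` and radius
`1 - p`, where `p > 0`, is `1`. -/
lemma eq_one_of_norm_sub_le {μ : ℂ} {p : ℝ} (hp : 0 < p) (hμ : ‖μ - p‖ ≤ 1 - p)
    (h1 : 1 ≤ ‖μ‖) : μ = 1 := by
  have h2 := pow_le_pow_left₀ (norm_nonneg _) hμ 2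
  have h3 := pow_le_pow_left₀ zero_le_one h1 2
  rw [Complex.sq_norm, Complex.normSq_apply] at h2 h3
  simp only [Complex.sub_re, Complex.sub_im, Complex.ofReal_re, Complex.ofReal_im] at h2
  have hre : 1 ≤ μ.re := by nlinarith
  have hre' : μ.re ≤ 1 := by
    have := (Complex.re_le_norm (μ - p)).trans hμ
    simp only [Complex.sub_re, Complex.ofReal_re] at this
    linarith
  have hre1 : μ.re = 1 := le_antisymm hre' hre
  have him : μ.im = 0 := by
    rw [hre1] at h2
    nlinarith
  exact Complex.ext (by simpa using hre1) (by simpa using him)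

/-- The spectrum of `1 + ε A - 𝟏 wᵀ` lies in the open unit disc when the diagonal of `1 + ε A`
is positive. -/
lemma norm_lt_one_of_mem_spectrum (hA : IsISM A) (h0 : SimpleZeroEig A) (hn : 1 ≤ n)
    (hw : ∑ i, w i = 1) (hwA : w ᵥ* A = 0) {ε : ℝ} (hε : 0 < ε) (hdiag : ∀ i, 0 < 1 + ε * A i i)
    {z : ℂ} (hz : z ∈ spectrum ℂ ((1 + ε • A - vecMulVec (fun _ => 1) w).map Complex.ofReal)) :
    ‖z‖ < 1 := by
  by_contra! hz1
  have hz0 : z ≠ 0 := by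
    rintro rfl
    norm_num at hz1
  rw [← Matrix.spectrum_toLin', ← Module.End.hasEigenvalue_iff_mem_spectrum] at hz
  obtain ⟨v, hv⟩ := hz.exists_hasEigenvector
  have hvz := hv.apply_eq_smul
  have hv0 := hv.2
  have hentry : ∀ i, v i + ε * ∑ j, (A i j : ℂ) * v j - ∑ j, (w j : ℂ) * v j = z * v i := by
    intro i
    have h := congrFun hvz i
    simpa [mulVec, dotProduct, Matrix.one_apply, add_mul, sub_mul, Finset.sum_add_distrib,
      Finset.sum_sub_distrib, Finset.mul_sum, mul_assoc, vecMulVec_apply, ite_mul, apply_ite] using h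
  have hwA' : ∑ i, (w i : ℂ) * ∑ j, (A i j : ℂ) * v j = 0 := by
    simp_rw [Finset.mul_sum]
    rw [Finset.sum_comm]
    refine Finset.sum_eq_zero fun j _ => ?_
    have h : ∑ i, (w i : ℂ) * (A i j : ℂ) = 0 := by
      have := congrFun hwA j
      simp only [vecMul, dotProduct, Pi.zero_apply] at this
      exact_mod_cast this
    simp_rw [← mul_assoc, ← Finset.sum_mul, h, zero_mul]
  have hwc : ∑ i, (w i : ℂ) = 1 := by exact_mod_cast hw
  have hwv : ∑ j, (w j : ℂ) * v j = 0 := by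
    have h : ∑ i, (w i : ℂ) * (v i + ε * ∑ j, (A i j : ℂ) * v j - ∑ j, (w j : ℂ) * v j)
        = ∑ i, (w i : ℂ) * (z * v i) := by simp_rw [hentry]
    simp_rw [mul_sub, mul_add, Finset.sum_sub_distrib, Finset.sum_add_distrib, ← Finset.sum_mul,
      mul_left_comm _ (ε : ℂ), mul_left_comm _ z, ← Finset.mul_sum, hwA', hwc] at h
    have : z * ∑ j, (w j : ℂ) * v j = 0 := by rw [← h]; ring
    exact (mul_eq_zero.mp this).resolve_left hz0
  simp_rw [hwv, sub_zero] at hentry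
  have heig : Module.End.HasEigenvalue
      (toLin' ((1 + ε • A : Matrix (Fin n) (Fin n) ℝ).map Complex.ofReal)) z := by
    refine Module.End.hasEigenvalue_of_hasEigenvector (x := v)
      ⟨Module.End.mem_eigenspace_iff.mpr ?_, hv0⟩
    ext i
    simpa [mulVec, dotProduct, Matrix.one_apply, add_mul, Finset.sum_add_distrib,
      Finset.mul_sum, mul_assoc, ite_mul, apply_ite] using hentry i
  obtain ⟨k, hk⟩ := eigenvalue_mem_ball heig
  have hradius : ∑ j ∈ Finset.univ.erase k,
      ‖((1 + ε • A : Matrix (Fin n) (Fin n) ℝ).map Complex.ofReal) k j‖ = 1 - (1 + ε * A k k) := by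
    have h := hA.2 k
    rw [← Finset.add_sum_erase _ _ (Finset.mem_univ k)] at h
    calc _ = ∑ j ∈ Finset.univ.erase k, ε * A k j := by
          refine Finset.sum_congr rfl fun j hj => ?_
          have hkj := (Finset.ne_of_mem_erase hj).symm
          have := hA.1 k j hkj
          simp [Matrix.one_apply_ne hkj, abs_of_pos hε, abs_of_nonneg this]
      _ = _ := by rw [← Finset.mul_sum]; linear_combination ε * h
  rw [hradius, mem_closedBall_iff_norm] at hk
  have hz_one : z = 1 := eq_one_of_norm_sub_le (hdiag k) (by simpa using hk) hz1
  refine hv0 (eq_zero_of_mulVec_map_ofReal_eq_zero hA h0 hn hw ?_ hwv)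
  ext i
  have h := hentry i
  rw [hz_one, one_mul, add_eq_left] at h
  simpa [mulVec, dotProduct, hε.ne'] using h

end Spectrum

section Norm

open scoped Matrix.Norms.Operator

lemma norm_map_ofReal {m : ℕ} (B : Matrix (Fin m) (Fin m) ℝ) :
    ‖B.map Complex.ofReal‖ = ‖B‖ := by
  simp [Matrix.linfty_opNorm_def]

end Norm

/-- For a rooted digraph `G` and `A ∈ 𝔸_G(w)`, the matrix exponential `exp (t A)`
converges, as `t → ∞`, to the rank-one matrix `𝟏 ⬝ wᵀ`. -/
theorem matExp_tendsto_one_mul_w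
    (n : ℕ) (hn : 1 ≤ n) (E : Fin n → Fin n → Prop) (hsimple : ∀ i, ¬ E i i)
    (hrooted : Rooted E) (w : Fin n → ℝ) (hw : MemSimplex w)
    (A : Matrix (Fin n) (Fin n) ℝ) (hA : Feasible E w A) :
    Filter.Tendsto (fun t : ℝ => matExp (t • A)) Filter.atTop
      (nhds (Matrix.vecMulVec (fun _ => (1 : ℝ)) w)) := by
  open scoped Matrix.Norms.Operator in
  obtain ⟨hISM, -, h0, hker⟩ := hA
  have hwA : w ᵥ* A = 0 := by rwa [mulVec_transpose] at hker
  have hone : A *ᵥ (fun _ => (1 : ℝ)) = 0 := by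
    ext i
    simpa [mulVec, dotProduct] using hISM.2 i
  have hsum := hw.2
  have : Nonempty (Fin n) := ⟨⟨0, hn⟩⟩
  set M : ℝ := 1 + ∑ i, |A i i| with hM
  have hM0 : 0 < M := by positivity
  have hdiag : ∀ i, 0 < 1 + M⁻¹ * A i i := fun i => by
    have h1 := Finset.single_le_sum (f := fun i => |A i i|) (fun i _ => abs_nonneg _)
      (Finset.mem_univ i)
    have h2 := neg_abs_le (A i i)
    have h3 : 0 < M + A i i := by linarith
    have h4 : 1 + M⁻¹ * A i i = M⁻¹ * (M + A i i) := by field_simp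
    rw [h4]
    positivity
  set J : Matrix (Fin n) (Fin n) ℝ := vecMulVec (fun _ => (1 : ℝ)) w with hJdef
  set Q : Matrix (Fin n) (Fin n) ℝ := 1 + M⁻¹ • A - J with hQdef
  have hJ : J * J = J := by
    rw [hJdef, vecMulVec_mul_vecMulVec]
    simp [dotProduct, hsum]
  have hAJ : A * J = 0 := by rw [hJdef, mul_vecMulVec, hone, zero_vecMulVec]
  have hJA : J * A = 0 := by rw [hJdef, vecMulVec_mul, hwA, vecMulVec_zero]
  have hQJ : Q * J = 0 := by simp [hQdef, sub_mul, add_mul, hAJ, hJ]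
  have hJQ : J * Q = 0 := by simp [hQdef, mul_sub, mul_add, hJA, hJ]
  obtain ⟨C, r, -, hr, hC⟩ := exists_norm_pow_le_geometric (Q.map Complex.ofReal)
    fun z hz => norm_lt_one_of_mem_spectrum hISM h0 hn hsum hwA (inv_pos.mpr hM0) hdiag hz
  have hCQ : ∀ k : ℕ, ‖Q ^ k‖ ≤ C * r ^ k := fun k => by
    rw [← norm_map_ofReal]
    have h : (Q ^ k).map Complex.ofReal = (Q.map Complex.ofReal) ^ k :=
      map_pow (Complex.ofRealHom.mapMatrix) Q k
    rw [h]
    exact hC k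
  have hlim := (tendsto_exp_smul_add_sub_one hQJ hJQ hJ hr hCQ).comp
    (Filter.tendsto_id.atTop_mul_const hM0)
  refine hlim.congr fun t => ?_
  have hgen : (t * M) • (Q + J - 1) = t • A := by
    rw [hQdef, sub_add_cancel, add_sub_cancel_left, smul_smul, mul_assoc,
      mul_inv_cancel₀ hM0.ne', mul_one]
  simp only [Function.comp_apply, id, hgen, NormedSpace.exp_eq_tsum ℝ]
  rfl
end
end
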